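/- arXiv:1310.0409 — 2 statements merged into one kernel-verified Lean document; each statement's English description precedes it below -/
import Mathlib

section
/- Assume the continuum hypothesis (2^{ℵ₀} = ℵ₁). Let X be a Tychonoff (completely regular Hausdorff) space with points G_δ (every singleton is the intersection of countably many open sets). If player II has a winning strategy in the game G_fin^{ω₁}(𝒪,𝒪) on X, then |X| ≤ 2^{ℵ₀}. -/
open Cardinal Set

/-- `C` is an open cover of the space `X`: a family of open sets whose union is `X`. -/
def IsOpenCover {X : Type*} [TopologicalSpace X] (C : Set (Set X)) : Prop :=
  (∀ U ∈ C, IsOpen U) ∧ ⋃₀ C = Set.univ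

/-- Player II has a winning strategy in the game `G_fin^len(𝒪,𝒪)` on `X`. -/
def PlayerIIWinsGfinOO (X : Type*) [TopologicalSpace X] (len : Ordinal) : Prop :=
  ∃ σ : (ξ : Ordinal) → ξ < len → ((η : Ordinal) → η ≤ ξ → Set (Set X)) → Set (Set X),
    (∀ (ξ : Ordinal) (hξ : ξ < len) (h : (η : Ordinal) → η ≤ ξ → Set (Set X)),
      (∀ η hη, IsOpenCover (h η hη)) → σ ξ hξ h ⊆ h ξ le_rfl ∧ (σ ξ hξ h).Finite) ∧
    (∀ U : Ordinal → Set (Set X), (∀ ξ < len, IsOpenCover (U ξ)) →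
      ⋃₀ (⋃ ξ : Ordinal, ⋃ hξ : ξ < len, σ ξ hξ fun η _ => U η) = Set.univ)

/-- `X` has points `G_δ`: every singleton is the intersection of countably many open sets. -/
def PointsGDelta (X : Type*) [TopologicalSpace X] : Prop :=
  ∀ x : X, ∃ 𝒰 : ℕ → Set X, (∀ n, IsOpen (𝒰 n)) ∧ (⋂ n, 𝒰 n) = {x}

open Filter Topology

universe u v w

/-- A union of at most continuum many sets of size at most continuum has size at most
continuum. -/
theorem mk_iUnion_le_continuum {α : Type u} {ι : Type v} (f : ι → Set α) (hι : #ι ≤ 𝔠)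
    (hf : ∀ i, #(f i) ≤ 𝔠) : #(⋃ i, f i) ≤ 𝔠 := by
  rw [← Cardinal.lift_le.{v}]
  refine (mk_iUnion_le_sum_mk_lift (f := f)).trans ?_
  calc Cardinal.sum (fun i => #(f i)) ≤ Cardinal.sum (fun _ : ι => (𝔠 : Cardinal.{u})) :=
        Cardinal.sum_le_sum _ _ hf
    _ = Cardinal.lift.{u} #ι * Cardinal.lift.{v} (𝔠 : Cardinal.{u}) := Cardinal.sum_const _ _
    _ ≤ 𝔠 * 𝔠 := by
        gcongr
        · simpa using hι
        · simp
    _ = Cardinal.lift.{v} 𝔠 := by simp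

/-- Continuum many operations of countable arity admit a closed set of size at most continuum
containing any given point. -/
theorem exists_mem_closed_under_ops {X : Type u} {I : Type} (hI : #I ≤ 𝔠)
    (op : I → (ℕ → X) → X) (x₀ : X) :
    ∃ M : Set X, x₀ ∈ M ∧ #M ≤ 𝔠 ∧ ∀ i f, (∀ n, f n ∈ M) → op i f ∈ M := by
  let β : Option I → Type := fun o => o.elim Empty (fun _ => ℕ)
  let step : (Σ a, β a → X) → X := fun p =>
    match p with
    | ⟨none, _⟩ => x₀
    | ⟨some i, f⟩ => op i f
  refine ⟨range (WType.elim X step), ⟨⟨none, Empty.elim⟩, rfl⟩, ?_, ?_⟩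
  · have hW : #(WType β) ≤ 𝔠 := by
      apply WType.cardinalMk_le_of_le
      calc Cardinal.sum (fun a => 𝔠 ^ #(β a)) ≤ Cardinal.sum (fun _ : Option I => 𝔠) := by
            refine Cardinal.sum_le_sum _ _ fun a => ?_
            cases a with
            | none =>
              have : #(β none) = 0 := Cardinal.mk_eq_zero Empty
              rw [this, Cardinal.power_zero]
              exact Cardinal.one_le_aleph0.trans Cardinal.aleph0_le_continuum
            | some i =>
              have : #(β (some i)) = ℵ₀ := Cardinal.mk_nat
              rw [this, Cardinal.continuum_power_aleph0]
        _ ≤ 𝔠 * 𝔠 := by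
            rw [Cardinal.sum_const']
            gcongr
            rw [Cardinal.mk_option]
            exact (add_le_add hI (Cardinal.one_le_aleph0.trans
              Cardinal.aleph0_le_continuum)).trans_eq Cardinal.continuum_add_self
        _ = 𝔠 := Cardinal.continuum_mul_self
    rw [← Cardinal.lift_le.{0}]
    refine Cardinal.mk_range_le_lift.trans ?_
    rw [← Cardinal.lift_le.{u}] at hW
    simpa using hW
  · intro i f hf
    choose g hg using hf
    refine ⟨⟨some i, g⟩, ?_⟩
    change op i (fun n => WType.elim X step (g n)) = op i f
    congr 1
    exact funext hg

theorem PointsGDelta.subtype {X : Type u} [TopologicalSpace X] (h : PointsGDelta X) (K : Set X) :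
    PointsGDelta K := by
  intro x
  obtain ⟨U, hU, hx⟩ := h x
  refine ⟨fun n => Subtype.val ⁻¹' U n, fun n => (hU n).preimage continuous_subtype_val, ?_⟩
  rw [← preimage_iInter, hx]
  ext y
  simp [Subtype.ext_iff]

/-- A compact Hausdorff space with points `G_δ` is first countable. -/
theorem PointsGDelta.firstCountableTopology {K : Type u} [TopologicalSpace K] [CompactSpace K]
    [T2Space K] (h : PointsGDelta K) : FirstCountableTopology K := by
  refine ⟨fun x => ?_⟩
  obtain ⟨U, hU, hx⟩ := h x
  have hxU : ∀ n, x ∈ U n := fun n => by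
    have : x ∈ ⋂ n, U n := by rw [hx]; rfl
    exact mem_iInter.1 this n
  choose V hV hVc hVU using fun n =>
    exists_mem_nhds_isClosed_subset ((hU n).mem_nhds (hxU n))
  have hbasis : (𝓝 x).HasBasis (fun _ : ℕ => True) (fun n => ⋂ i ∈ Iic n, V i) := by
    refine ⟨fun s => ⟨fun hs => ?_, ?_⟩⟩
    · have := exists_subset_nhds_of_compactSpace (V := fun n => ⋂ i ∈ Iic n, V i) (U := s)
        (directed_of_isDirected_le fun m n hmn =>
          biInter_subset_biInter_left (Iic_subset_Iic.2 hmn))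
        (fun n => isClosed_biInter fun i _ => hVc i) (fun y hy => by
          have : y ∈ ⋂ n, U n := mem_iInter.2 fun n =>
            hVU n (mem_iInter₂.1 (mem_iInter.1 hy n) n self_mem_Iic)
          rw [hx, mem_singleton_iff] at this
          rwa [this])
      simpa using this
    · rintro ⟨n, -, hn⟩
      exact mem_of_superset ((biInter_mem (finite_Iic n)).2 fun i _ => hV i) hn
  exact hbasis.isCountablyGenerated

/-- A compact Hausdorff space with points `G_δ` has size at most continuum. -/
theorem PointsGDelta.mk_le_continuum {K : Type u} [TopologicalSpace K] [CompactSpace K]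
    [T2Space K] (h : PointsGDelta K) : #K ≤ 𝔠 := by
  classical
  have := h.firstCountableTopology
  rcases isEmpty_or_nonempty K with hK | ⟨⟨x₀⟩⟩
  · simp
  have : Nonempty K := ⟨x₀⟩
  choose U hU hx using h
  have hxU : ∀ x n, x ∈ U x n := fun x n => by
    have : x ∈ ⋂ n, U x n := by rw [hx]; rfl
    exact mem_iInter.1 this n
  let op : Option (ℕ × (ℕ → ℕ)) → (ℕ → K) → K := fun o f =>
    match o with
    | none => limUnder atTop f
    | some (k, n) => if h : ∃ y, y ∉ ⋃ i ∈ Iio k, U (f i) (n i) then h.choose else x₀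
  obtain ⟨M, hx₀, hM, hop⟩ := exists_mem_closed_under_ops
    (by simp [Cardinal.add_one_eq Cardinal.aleph0_le_continuum]) op x₀
  have hMc : IsClosed M := by
    refine isClosed_of_closure_subset fun x hxM => ?_
    obtain ⟨f, hf, hfx⟩ := mem_closure_iff_seq_limit.1 hxM
    have := hop none f hf
    rwa [show op none f = x from hfx.limUnder_eq] at this
  suffices M = Set.univ by rwa [this, Cardinal.mk_univ] at hM
  refine eq_univ_of_forall fun y => ?_
  by_contra hy
  have hn : ∀ x : K, ∃ n, x ∈ M → y ∉ U x n := by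
    intro x
    by_cases hxM : x ∈ M
    · by_contra! hcon
      have : y ∈ ⋂ n, U x n := mem_iInter.2 fun n => (hcon n).2
      rw [hx, mem_singleton_iff] at this
      exact hy (this ▸ hxM)
    · exact ⟨0, fun h => absurd h hxM⟩
  choose n hn using hn
  obtain ⟨t, htM, ht⟩ := hMc.isCompact.elim_nhds_subcover (fun x => U x (n x))
    fun x _ => (hU x (n x)).mem_nhds (hxU x (n x))
  obtain ⟨f, hf⟩ : ∃ f : ℕ → K, (∀ i, f i ∈ M) ∧ ∃ k, ∀ x, x ∈ t ↔ ∃ i < k, f i = x := by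
    refine ⟨fun i => if h : i < t.card then (t.equivFin.symm ⟨i, h⟩ : t).1 else x₀, fun i => ?_,
      t.card, fun x => ⟨fun hxt => ?_, ?_⟩⟩
    · dsimp only
      split_ifs with h
      · exact htM _ (t.equivFin.symm ⟨i, h⟩).2
      · exact hx₀
    · exact ⟨t.equivFin ⟨x, hxt⟩, (t.equivFin ⟨x, hxt⟩).2, by simp⟩
    · rintro ⟨i, hi, rfl⟩
      simp only [hi, dif_pos]
      exact (t.equivFin.symm ⟨i, hi⟩).2
  obtain ⟨hfM, k, hfk⟩ := hf
  have hex : ∃ z, z ∉ ⋃ i ∈ Iio k, U (f i) (n (f i)) := by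
    refine ⟨y, fun hyU => ?_⟩
    obtain ⟨i, -, hi⟩ := mem_iUnion₂.1 hyU
    exact hn (f i) (hfM i) hi
  have hmem := hop (some (k, fun i => n (f i))) f hfM
  have hval : op (some (k, fun i => n (f i))) f = hex.choose := dif_pos hex
  rw [hval] at hmem
  refine hex.choose_spec ?_
  obtain ⟨x, hxt, hxz⟩ := mem_iUnion₂.1 (ht hmem)
  obtain ⟨i, hi, rfl⟩ := (hfk x).1 hxt
  exact mem_iUnion₂.2 ⟨i, hi, hxz⟩

/-- If finitely many members `S C` are selected from each open cover `C`, then the points lying in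
the closure of every selected union form a compact set. -/
theorem isCompact_iInter_closure_selection {X : Type u} [TopologicalSpace X] [T3Space X]
    (S : Set (Set X) → Set (Set X)) (hS : ∀ C, IsOpenCover C → S C ⊆ C ∧ (S C).Finite) :
    IsCompact (⋂ (C) (_ : IsOpenCover C), closure (⋃₀ S C)) := by
  classical
  set K := ⋂ (C) (_ : IsOpenCover C), closure (⋃₀ S C) with hK
  have hKc : IsClosed K := isClosed_iInter fun C => isClosed_iInter fun _ => isClosed_closure
  refine isCompact_of_finite_subcover fun {ι} U hU hKU => ?_
  let W : Set (Set X) := {V | IsOpen V ∧ ((∃ i, closure V ⊆ U i) ∨ closure V ⊆ Kᶜ)}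
  have hW : IsOpenCover W := by
    refine ⟨fun V hV => hV.1, eq_univ_of_forall fun x => ?_⟩
    have key : ∀ O : Set X, IsOpen O → x ∈ O → ∃ V, IsOpen V ∧ x ∈ V ∧ closure V ⊆ O := by
      intro O hO hxO
      obtain ⟨T, hT, hTc, hTO⟩ := exists_mem_nhds_isClosed_subset (hO.mem_nhds hxO)
      exact ⟨interior T, isOpen_interior, mem_interior_iff_mem_nhds.2 hT,
        (closure_minimal interior_subset hTc).trans hTO⟩
    by_cases hx : x ∈ K
    · obtain ⟨i, hi⟩ := mem_iUnion.1 (hKU hx)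
      obtain ⟨V, hV, hxV, hVU⟩ := key _ (hU i) hi
      exact ⟨V, ⟨hV, Or.inl ⟨i, hVU⟩⟩, hxV⟩
    · obtain ⟨V, hV, hxV, hVU⟩ := key _ hKc.isOpen_compl hx
      exact ⟨V, ⟨hV, Or.inr hVU⟩, hxV⟩
  obtain ⟨hsub, hfin⟩ := hS W hW
  have hpick : ∀ V : Set X, ∃ s : Finset ι, V ∈ S W → K ∩ closure V ⊆ ⋃ i ∈ s, U i := by
    intro V
    by_cases hV : V ∈ S W
    · rcases (hsub hV).2 with ⟨i, hi⟩ | hi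
      · exact ⟨{i}, fun _ => by simpa using inter_subset_right.trans hi⟩
      · exact ⟨∅, fun _ x hx => absurd hx.1 (hi hx.2)⟩
    · exact ⟨∅, fun h => absurd h hV⟩
  choose s hs using hpick
  refine ⟨hfin.toFinset.biUnion s, fun x hx => ?_⟩
  have hxc : x ∈ closure (⋃₀ S W) := mem_iInter₂.1 hx W hW
  rw [hfin.closure_sUnion] at hxc
  obtain ⟨V, hV, hxV⟩ := mem_iUnion₂.1 hxc
  obtain ⟨i, hi, hxi⟩ := mem_iUnion₂.1 (hs V hV ⟨hx, hxV⟩)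
  exact mem_iUnion₂.2 ⟨i, Finset.mem_biUnion.2 ⟨V, hfin.mem_toFinset.2 hV, hi⟩, hxi⟩

theorem isOpenCover_singleton_univ {X : Type u} [TopologicalSpace X] :
    IsOpenCover ({Set.univ} : Set (Set X)) :=
  ⟨fun U hU => by rw [mem_singleton_iff.1 hU]; exact isOpen_univ, sUnion_singleton _⟩

/-- If finitely many members are selected from each open cover, then continuum many covers suffice
to make the selected unions miss every point outside a set of size at most continuum. -/
theorem exists_small_family_of_covers {X : Type u} [TopologicalSpace X] [T3Space X]
    (hGδ : PointsGDelta X)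
    (hL : ∀ C : Set (Set X), IsOpenCover C → ∃ D ⊆ C, #D ≤ 𝔠 ∧ ⋃₀ D = Set.univ)
    (S : Set (Set X) → Set (Set X)) (hS : ∀ C, IsOpenCover C → S C ⊆ C ∧ (S C).Finite) :
    ∃ (K : Set X) (C : ℝ → {C : Set (Set X) // IsOpenCover C}), #K ≤ 𝔠 ∧
      ∀ y ∉ K, ∃ i, y ∉ ⋃₀ S (C i) := by
  classical
  have hKcomp := isCompact_iInter_closure_selection S hS
  set K := ⋂ (C) (_ : IsOpenCover C), closure (⋃₀ S C) with hK
  have hKcard : #K ≤ 𝔠 := by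
    have := isCompact_iff_compactSpace.1 hKcomp
    exact (hGδ.subtype K).mk_le_continuum
  choose U hU hx using hGδ
  have hxU : ∀ x n, x ∈ U x n := fun x n => by
    have : x ∈ ⋂ n, U x n := by rw [hx]; rfl
    exact mem_iInter.1 this n
  let G : Finset (K × ℕ) → Set X := fun t => ⋃ p ∈ t, U p.1 p.2
  have hGo : ∀ t, IsOpen (G t) := fun t => isOpen_biUnion fun p _ => hU _ _
  let E : {t : Finset (K × ℕ) // K ⊆ G t} → Set (Set X) := fun t =>
    insert (G t) {d | ∃ W : {C : Set (Set X) // IsOpenCover C}, d = (closure (⋃₀ S W))ᶜ}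
  have hE : ∀ t, IsOpenCover (E t) := by
    intro t
    refine ⟨?_, eq_univ_of_forall fun x => ?_⟩
    · rintro V (rfl | ⟨W, rfl⟩)
      · exact hGo _
      · exact isClosed_closure.isOpen_compl
    · by_cases hxK : x ∈ K
      · exact ⟨G t, mem_insert _ _, t.2 hxK⟩
      · rw [hK] at hxK
        simp only [mem_iInter, not_forall] at hxK
        obtain ⟨W, hW, hxW⟩ := hxK
        exact ⟨_, mem_insert_of_mem _ ⟨⟨W, hW⟩, rfl⟩, hxW⟩
  choose D hDE hDc hDu using fun t => hL (E t) (hE t)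
  have hJ : #{t : Finset (K × ℕ) // K ⊆ G t} ≤ 𝔠 := by
    refine (mk_subtype_le _).trans ?_
    have hKN : #(K × ℕ) ≤ 𝔠 := by
      rw [Cardinal.mk_prod, Cardinal.mk_nat, Cardinal.lift_aleph0, Cardinal.lift_id']
      exact (mul_le_mul' hKcard Cardinal.aleph0_le_continuum).trans_eq
        Cardinal.continuum_mul_self
    rcases finite_or_infinite (K × ℕ) with hfin | hinf
    · exact (Cardinal.mk_le_aleph0).trans Cardinal.aleph0_le_continuum
    · rwa [Cardinal.mk_finset_of_infinite]
  have hT : #(⋃ t, D t) ≤ 𝔠 := mk_iUnion_le_continuum D hJ hDc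
  obtain ⟨e⟩ : Nonempty ((⋃ t, D t : Set (Set X)) ↪ ℝ) := by
    rw [← Cardinal.lift_mk_le'.{u, 0}, Cardinal.mk_real]
    simpa using hT
  let c : ℝ → {C : Set (Set X) // IsOpenCover C} := fun r =>
    if h : ∃ W : {C : Set (Set X) // IsOpenCover C}, ∃ d : (⋃ t, D t : Set (Set X)),
        e d = r ∧ d.1 = (closure (⋃₀ S W))ᶜ
    then h.choose else ⟨{Set.univ}, isOpenCover_singleton_univ⟩
  refine ⟨K, c, hKcard, fun y hy => ?_⟩
  have hn : ∀ x : K, ∃ n, y ∉ U x n := by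
    intro x
    by_contra! hcon
    have : y ∈ ⋂ n, U x n := mem_iInter.2 hcon
    rw [hx, mem_singleton_iff] at this
    exact hy (this ▸ x.2)
  choose n hn using hn
  obtain ⟨t, ht⟩ := hKcomp.elim_finite_subcover (fun x : K => U x (n x)) (fun x => hU _ _)
    fun x hxK => mem_iUnion.2 ⟨⟨x, hxK⟩, hxU _ _⟩
  let j : {t : Finset (K × ℕ) // K ⊆ G t} := ⟨t.image fun x => (x, n x), by
    rwa [show G (t.image fun x => (x, n x)) = ⋃ x ∈ t, U x (n x) from
      Finset.set_biUnion_finset_image]⟩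
  have hyG : y ∉ G j := by
    intro hyG
    obtain ⟨p, hp, hyp⟩ := mem_iUnion₂.1 hyG
    obtain ⟨x, -, rfl⟩ := Finset.mem_image.1 hp
    exact hn x hyp
  obtain ⟨d, hd, hyd⟩ : y ∈ ⋃₀ D j := by rw [hDu]; trivial
  rcases hDE j hd with rfl | ⟨W, hW⟩
  · exact absurd hyd hyG
  let d' : (⋃ t, D t : Set (Set X)) := ⟨d, mem_iUnion.2 ⟨j, hd⟩⟩
  have hex : ∃ W : {C : Set (Set X) // IsOpenCover C}, ∃ d'' : (⋃ t, D t : Set (Set X)),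
      e d'' = e d' ∧ d''.1 = (closure (⋃₀ S W))ᶜ := ⟨W, d', rfl, hW⟩
  have hc : c (e d') = hex.choose := dif_pos hex
  refine ⟨e d', ?_⟩
  obtain ⟨d'', hd'', hval⟩ := hex.choose_spec
  rw [hc]
  have : d'' = d' := e.injective hd''
  subst this
  intro hmem
  have hyd' : y ∈ (closure (⋃₀ S hex.choose))ᶜ := hval ▸ hyd
  exact hyd' (subset_closure hmem)

theorem mk_Iio_ord_aleph_one_le_continuum :
    #(Iio (Cardinal.aleph 1).ord : Set Ordinal.{w}) ≤ 𝔠 := by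
  rw [Cardinal.mk_Iio_ordinal, Cardinal.card_ord]
  simpa using Cardinal.aleph_one_le_continuum

/-- If player II wins the game of length `ω₁`, every open cover has a subcover of size at most
continuum. -/
theorem PlayerIIWinsGfinOO.exists_subcover {X : Type u} [TopologicalSpace X]
    (hwin : PlayerIIWinsGfinOO X (Cardinal.aleph.{w} 1).ord) (C : Set (Set X))
    (hC : IsOpenCover C) : ∃ D ⊆ C, #D ≤ 𝔠 ∧ ⋃₀ D = Set.univ := by
  obtain ⟨σ, hσ, hw⟩ := hwin
  refine ⟨⋃ ξ : Iio (Cardinal.aleph.{w} 1).ord, σ ξ.1 ξ.2 fun _ _ => C, ?_, ?_, ?_⟩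
  · exact iUnion_subset fun ξ => (hσ ξ.1 ξ.2 _ fun _ _ => hC).1
  · refine mk_iUnion_le_continuum _ mk_Iio_ord_aleph_one_le_continuum fun ξ => ?_
    have := (hσ ξ.1 ξ.2 (fun _ _ => C) fun _ _ => hC).2
    exact (Cardinal.mk_le_aleph0_iff.2 this.countable.to_subtype).trans
      Cardinal.aleph0_le_continuum
  · rw [← hw (fun _ => C) fun _ _ => hC]
    congr 1
    exact iUnion_subtype _ _

/-- The transfinite sequence whose term at `ξ` is computed by `F` from the earlier terms and the
parameter `s ξ`. -/
noncomputable def transfinitePlay {α : Type u} (F : (ξ : Ordinal.{w}) → (Iio ξ → α) → ℝ → α)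
    (s : Ordinal.{w} → ℝ) (ξ : Ordinal.{w}) : α :=
  F ξ (fun η => transfinitePlay F s η.1) (s ξ)
termination_by ξ
decreasing_by exact η.2

theorem transfinitePlay_congr {α : Type u} (F : (ξ : Ordinal.{w}) → (Iio ξ → α) → ℝ → α)
    {s s' : Ordinal.{w} → ℝ} (ξ : Ordinal.{w}) (h : ∀ η ≤ ξ, s η = s' η) :
    transfinitePlay F s ξ = transfinitePlay F s' ξ := by
  induction ξ using WellFoundedLT.induction with
  | ind ξ ih =>
    rw [transfinitePlay, transfinitePlay, h ξ le_rfl]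
    congr 1
    funext η
    exact ih η.1 η.2 fun ζ hζ => h ζ (hζ.trans η.2.le)

/-- The parameters of a transfinite play may be chosen depending on the earlier terms. -/
theorem exists_transfinitePlay_param {α : Type u}
    (F : (ξ : Ordinal.{w}) → (Iio ξ → α) → ℝ → α)
    (g : (ξ : Ordinal.{w}) → (Iio ξ → α) → ℝ) :
    ∃ s : Ordinal.{w} → ℝ, ∀ ξ, s ξ = g ξ fun η => transfinitePlay F s η.1 := by
  let u : Ordinal.{w} → α := transfinitePlay (fun ξ p _ => F ξ p (g ξ p)) fun _ => 0
  have hu : ∀ ξ, u ξ = F ξ (fun η => u η.1) (g ξ fun η => u η.1) := fun ξ => by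
    simp only [u]
    rw [transfinitePlay]
  let s : Ordinal.{w} → ℝ := fun ξ => g ξ fun η => u η.1
  have hs : ∀ ξ, transfinitePlay F s ξ = u ξ := by
    intro ξ
    induction ξ using WellFoundedLT.induction with
    | ind ξ ih =>
      rw [transfinitePlay, hu]
      have : (fun η : Iio ξ => transfinitePlay F s η.1) = fun η => u η.1 :=
        funext fun η => ih η.1 η.2
      rw [this]
  exact ⟨s, fun ξ => by simp only [hs, s]⟩

/-- Sets of size at most continuum attached to all countable positions of transfinite plays cover
at most continuum many points. -/
theorem mk_le_continuum_of_transfinitePlay {X : Type v} {α : Type u}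
    (F : (ξ : Ordinal.{w}) → (Iio ξ → α) → ℝ → α)
    (K : (ξ : Ordinal.{w}) → (Iio ξ → α) → Set X) (hK : ∀ ξ p, #(K ξ p) ≤ 𝔠)
    (hcov : ∀ y, ∃ s, ∃ ξ < (Cardinal.aleph 1).ord, y ∈ K ξ fun η => transfinitePlay F s η.1) :
    #X ≤ 𝔠 := by
  have hcount : ∀ ξ : Iio (Cardinal.aleph.{w} 1).ord, ∃ e : Ordinal.{w} → ℕ,
      InjOn e (Iio ξ.1) := by
    intro ξ
    apply Set.countable_iff_exists_injOn.1
    rw [← Cardinal.le_aleph0_iff_set_countable, Cardinal.mk_Iio_ordinal, Cardinal.lift_le_aleph0,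
      ← Cardinal.lt_aleph_one_iff]
    exact Cardinal.lt_ord.1 ξ.2
  choose e he using hcount
  let A : Iio (Cardinal.aleph.{w} 1).ord × (ℕ → ℝ) → Set X := fun q =>
    K q.1.1 fun η => transfinitePlay F (fun ζ => q.2 (e q.1 ζ)) η.1
  have hidx : #(Iio (Cardinal.aleph.{w} 1).ord × (ℕ → ℝ)) ≤ 𝔠 := by
    rw [Cardinal.mk_prod]
    refine (mul_le_mul' (b := 𝔠) (d := 𝔠) ?_ ?_).trans_eq Cardinal.continuum_mul_self
    · simpa using mk_Iio_ord_aleph_one_le_continuum.{w}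
    · simp [Cardinal.mk_real]
  have huniv : ⋃ q, A q = Set.univ := by
    refine eq_univ_of_forall fun y => ?_
    obtain ⟨s, ξ, hξ, hy⟩ := hcov y
    refine mem_iUnion.2
      ⟨(⟨ξ, hξ⟩, fun n => s (Function.invFunOn (e ⟨ξ, hξ⟩) (Iio ξ) n)), ?_⟩
    have hplay : (fun η : Iio ξ => transfinitePlay F
        (fun ζ => s (Function.invFunOn (e ⟨ξ, hξ⟩) (Iio ξ) (e ⟨ξ, hξ⟩ ζ))) η.1) =
        fun η => transfinitePlay F s η.1 := funext fun η =>
      transfinitePlay_congr F _ fun ζ hζ =>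
        congrArg s ((he ⟨ξ, hξ⟩).leftInvOn_invFunOn (hζ.trans_lt η.2))
    rw [← hplay] at hy
    exact hy
  rw [← Cardinal.mk_univ, ← huniv]
  exact mk_iUnion_le_continuum A hidx fun q => hK _ _

/-- [CH] If `X` is a Tychonoff space with points `G_δ` and player II has a winning
strategy in `G_fin^{ω₁}(𝒪,𝒪)` on `X`, then `|X| ≤ 2^{ℵ₀}`. -/
theorem stmt9 {X : Type*} [TopologicalSpace X] [T35Space X]
    (CH : Cardinal.continuum = Cardinal.aleph 1)
    (hGδ : PointsGDelta X)
    (hwin : PlayerIIWinsGfinOO X (Cardinal.aleph 1).ord) :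
    #X ≤ Cardinal.continuum := by
  classical
  have hL := hwin.exists_subcover
  obtain ⟨σ, hσ, hw⟩ := hwin
  have hstep : ∀ (ξ : Ordinal) (p : Iio ξ → {C : Set (Set X) // IsOpenCover C}),
      ∃ (K : Set X) (C : ℝ → {C : Set (Set X) // IsOpenCover C}), #K ≤ 𝔠 ∧
        ∀ hξ : ξ < (Cardinal.aleph 1).ord, ∀ y ∉ K, ∃ i,
          y ∉ ⋃₀ σ ξ hξ fun η _ => if h : η < ξ then (p ⟨η, h⟩).1 else (C i).1 := by
    intro ξ p
    by_cases hξ : ξ < (Cardinal.aleph 1).ord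
    · obtain ⟨K, C, hK, hC⟩ := exists_small_family_of_covers hGδ hL
        (fun W => σ ξ hξ fun η _ => if h : η < ξ then (p ⟨η, h⟩).1 else W) (fun W hW => by
          have := hσ ξ hξ (fun η _ => if h : η < ξ then (p ⟨η, h⟩).1 else W) (fun η _ => by
            split_ifs with h
            · exact (p ⟨η, h⟩).2
            · exact hW)
          simpa using this)
      exact ⟨K, C, hK, fun _ => hC⟩
    · exact ⟨∅, fun _ => ⟨{Set.univ}, isOpenCover_singleton_univ⟩, by simp, fun h => absurd h hξ⟩
  choose K F hK hF using hstep
  refine mk_le_continuum_of_transfinitePlay F K hK fun y => ?_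
  by_contra! hy
  obtain ⟨s, hs⟩ := exists_transfinitePlay_param F fun ξ p =>
    if h : ∃ i, ∃ hξ : ξ < (Cardinal.aleph 1).ord,
      y ∉ ⋃₀ σ ξ hξ fun η _ => if h : η < ξ then (p ⟨η, h⟩).1 else (F ξ p i).1
    then h.choose else 0
  have hcover := hw (fun ξ => (transfinitePlay F s ξ).1) fun ξ _ => (transfinitePlay F s ξ).2
  obtain ⟨V, hV, hyV⟩ : y ∈ ⋃₀ (⋃ ξ : Ordinal, ⋃ hξ : ξ < (Cardinal.aleph 1).ord,
      σ ξ hξ fun η _ => (transfinitePlay F s η).1) := by rw [hcover]; trivial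
  obtain ⟨ξ, hξ, hVσ⟩ := mem_iUnion₂.1 hV
  obtain ⟨i, hi⟩ := hF ξ (fun η => transfinitePlay F s η.1) hξ y (hy s ξ hξ)
  have hex : ∃ i, ∃ hξ : ξ < (Cardinal.aleph 1).ord, y ∉ ⋃₀ σ ξ hξ fun η _ =>
      if h : η < ξ then (transfinitePlay F s η).1
      else (F ξ (fun η => transfinitePlay F s η.1) i).1 := ⟨i, hξ, hi⟩
  have hsξ : s ξ = hex.choose := (hs ξ).trans (dif_pos hex)
  obtain ⟨_, hmiss⟩ := hex.choose_spec
  rw [← hsξ] at hmiss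
  have hplay : (fun (η : Ordinal) (_ : η ≤ ξ) => if h : η < ξ then (transfinitePlay F s η).1
      else (F ξ (fun η => transfinitePlay F s η.1) (s ξ)).1) =
      fun η _ => (transfinitePlay F s η).1 := by
    funext η hη
    split_ifs with h
    · rfl
    · obtain rfl : η = ξ := hη.antisymm (not_lt.1 h)
      conv_rhs => rw [transfinitePlay]
  rw [hplay] at hmiss
  exact hmiss ⟨V, hVσ, hyV⟩
end

section
/- Assume the continuum hypothesis (2^{ℵ₀} = ℵ₁). Let X be a Tychonoff (completely regular Hausdorff) space. Then player II has a winning strategy in the game G_fin^{ω₁}(𝒪,𝒪) on X if and only if player II has a winning strategy in the game G₁^{ω₁}(𝒦,𝒪) on X. -/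
open Cardinal Set

/-- `C` is a `K`-cover of `X`: an open cover such that every compact subset of `X` is
contained in some member of `C`. -/
def IsKCover {X : Type*} [TopologicalSpace X] (C : Set (Set X)) : Prop :=
  IsOpenCover C ∧ ∀ K : Set X, IsCompact K → ∃ U ∈ C, K ⊆ U

/-- Player II has a winning strategy in the game `G₁^len(𝒦,𝒪)` on `X`. -/
def PlayerIIWinsG1KO (X : Type*) [TopologicalSpace X] (len : Ordinal) : Prop :=
  ∃ F : (ξ : Ordinal) → ξ < len → ((η : Ordinal) → η ≤ ξ → Set (Set X)) → Set X,
    (∀ (ξ : Ordinal) (hξ : ξ < len) (h : (η : Ordinal) → η ≤ ξ → Set (Set X)),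
      (∀ η hη, IsKCover (h η hη)) → F ξ hξ h ∈ h ξ le_rfl) ∧
    (∀ U : Ordinal → Set (Set X), (∀ ξ < len, IsKCover (U ξ)) →
      ⋃₀ {V | ∃ ξ, ∃ hξ : ξ < len, V = F ξ hξ fun η _ => U η} = Set.univ)

/-! ### Transfinite games indexed by a well-ordered type -/

/-- The `ξ`-th value of `σ` is determined by the entries of the input up to `ξ`. -/
def DependsOnPast {Ω S Y : Type*} [LE Ω] (σ : Ω → (Ω → S) → Y) : Prop :=
  ∀ ξ U U', (∀ η ≤ ξ, U η = U' η) → σ ξ U = σ ξ U'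

/-- Player II wins `G_fin(𝒪,𝒪)` with innings indexed by `Ω`. -/
def WinsGfinOn (Ω X : Type*) [LE Ω] [TopologicalSpace X] : Prop :=
  ∃ σ : Ω → (Ω → {C : Set (Set X) // IsOpenCover C}) → Set (Set X),
    DependsOnPast σ ∧ (∀ ξ U, σ ξ U ⊆ (U ξ).1 ∧ (σ ξ U).Finite) ∧
      ∀ U x, ∃ ξ, x ∈ ⋃₀ σ ξ U

/-- Player II wins `G₁(𝒦,𝒪)` with innings indexed by `Ω`. -/
def WinsG1On (Ω X : Type*) [LE Ω] [TopologicalSpace X] : Prop :=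
  ∃ σ : Ω → (Ω → {C : Set (Set X) // IsKCover C}) → Set X,
    DependsOnPast σ ∧ (∀ ξ U, σ ξ U ∈ (U ξ).1) ∧ ∀ U x, ∃ ξ, x ∈ σ ξ U

section Transfer

variable {X Ω : Type*} [LinearOrder Ω] {len : Ordinal}

open Classical in
/-- The element of a subtype with a given value, or the default element. -/
noncomputable def toSubtype {α : Type*} (p : α → Prop) [Inhabited {a // p a}] (a : α) :
    {a // p a} :=
  if h : p a then ⟨a, h⟩ else default

theorem toSubtype_coe {α : Type*} {p : α → Prop} [Inhabited {a // p a}] {a : α} (h : p a) :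
    (toSubtype p a : α) = a := by
  simp [toSubtype, h]

open Classical in
/-- Extend a history on ordinals `η ≤ ξ` to an input on all of `Ω`. -/
noncomputable def extendHistory {p : Set (Set X) → Prop} [Inhabited {a // p a}]
    (o : Ω ≃o Iio len) (ξ : Ordinal) (h : (η : Ordinal) → η ≤ ξ → Set (Set X)) (i : Ω) :
    {a // p a} :=
  if hi : (o i).1 ≤ ξ then toSubtype p (h (o i).1 hi) else default

theorem extendHistory_symm {p : Set (Set X) → Prop} [Inhabited {a // p a}]
    (o : Ω ≃o Iio len) (ξ : Ordinal) (hξ : ξ < len)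
    (h : (η : Ordinal) → η ≤ ξ → Set (Set X)) (hp : p (h ξ le_rfl)) :
    (extendHistory (p := p) o ξ h (o.symm ⟨ξ, hξ⟩)).1 = h ξ le_rfl := by
  have key : ∀ (i : Iio len) (hi : i = ⟨ξ, hξ⟩) (hi' : i.1 ≤ ξ), h i.1 hi' = h ξ le_rfl := by
    rintro _ rfl _; rfl
  have hi : o (o.symm ⟨ξ, hξ⟩) = ⟨ξ, hξ⟩ := o.apply_symm_apply _
  have hi' : (o (o.symm ⟨ξ, hξ⟩)).1 ≤ ξ := (congrArg Subtype.val hi).le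
  rw [extendHistory, dif_pos hi', key _ hi hi', toSubtype_coe hp]

theorem extendHistory_restrict {p : Set (Set X) → Prop} [Inhabited {a // p a}] {Y : Type*}
    (o : Ω ≃o Iio len) {τ : Ω → (Ω → {a // p a}) → Y} (hτ : DependsOnPast τ)
    (U : Ordinal → Set (Set X)) (i : Ω) :
    τ i (extendHistory o (o i).1 fun η _ => U η) = τ i fun j => toSubtype p (U (o j).1) := by
  refine hτ _ _ _ fun η hη => ?_
  have : (o η).1 ≤ (o i).1 := o.monotone hη
  simp only [extendHistory, dif_pos this]

variable [TopologicalSpace X]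

theorem isKCover_singleton_univ : IsKCover ({Set.univ} : Set (Set X)) :=
  ⟨⟨by simp, by simp⟩, fun K _ => ⟨Set.univ, rfl, subset_univ K⟩⟩

instance : Inhabited {C : Set (Set X) // IsOpenCover C} :=
  ⟨⟨{Set.univ}, isKCover_singleton_univ.1⟩⟩

instance : Inhabited {C : Set (Set X) // IsKCover C} :=
  ⟨⟨{Set.univ}, isKCover_singleton_univ⟩⟩

theorem PlayerIIWinsGfinOO.winsGfinOn (o : Ω ≃o Iio len) (H : PlayerIIWinsGfinOO X len) :
    WinsGfinOn Ω X := by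
  obtain ⟨σ, h₁, h₂⟩ := H
  refine ⟨fun i U => σ (o i).1 (o i).2 fun η hη => (U (o.symm ⟨η, hη.trans_lt (o i).2⟩)).1,
    fun i U U' h => ?_, fun i U => ?_, fun U x => ?_⟩
  · refine congrArg (σ _ _) (funext₂ fun η hη => congrArg _ (h _ ?_))
    rw [OrderIso.symm_apply_le]
    exact hη
  · have := h₁ (o i).1 (o i).2 (fun η hη => (U (o.symm ⟨η, hη.trans_lt (o i).2⟩)).1)
      fun η hη => (U _).2
    rwa [show o.symm ⟨(o i).1, _⟩ = i from o.symm_apply_apply i] at this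
  · classical
    have := h₂ (fun η => if hη : η < len then (U (o.symm ⟨η, hη⟩)).1 else ∅)
      (fun ξ hξ => by simpa [hξ] using (U _).2)
    have hx := this.symm ▸ mem_univ x
    simp only [mem_sUnion, mem_iUnion] at hx ⊢
    obtain ⟨V, ⟨ξ, hξ, hV⟩, hxV⟩ := hx
    refine ⟨o.symm ⟨ξ, hξ⟩, V, ?_, hxV⟩
    have key : ∀ (i : Iio len) (hi : i = ⟨ξ, hξ⟩),
        V ∈ σ i.1 i.2 fun η hη => (U (o.symm ⟨η, hη.trans_lt i.2⟩)).1 := by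
      rintro _ rfl
      convert hV using 4 with η hη
      rw [dif_pos (hη.trans_lt hξ)]
    exact key _ (o.apply_symm_apply _)

theorem WinsGfinOn.playerIIWinsGfinOO (o : Ω ≃o Iio len) (H : WinsGfinOn Ω X) :
    PlayerIIWinsGfinOO X len := by
  obtain ⟨τ, h₁, h₂, h₃⟩ := H
  refine ⟨fun ξ hξ h => τ (o.symm ⟨ξ, hξ⟩) (extendHistory o ξ h), fun ξ hξ h hh => ?_,
    fun U hU => ?_⟩
  · have := h₂ (o.symm ⟨ξ, hξ⟩) (extendHistory o ξ h)
    rwa [extendHistory_symm o ξ hξ h (hh _ _)] at this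
  · refine eq_univ_of_forall fun x => ?_
    obtain ⟨i, V, hV, hx⟩ := h₃ (fun j => toSubtype _ (U (o j).1)) x
    simp only [mem_sUnion, mem_iUnion]
    refine ⟨V, ⟨(o i).1, (o i).2, ?_⟩, hx⟩
    rw [← extendHistory_restrict o h₁] at hV
    rwa [show o.symm ⟨(o i).1, _⟩ = i from o.symm_apply_apply i]

theorem PlayerIIWinsG1KO.winsG1On (o : Ω ≃o Iio len) (H : PlayerIIWinsG1KO X len) :
    WinsG1On Ω X := by
  obtain ⟨σ, h₁, h₂⟩ := H
  refine ⟨fun i U => σ (o i).1 (o i).2 fun η hη => (U (o.symm ⟨η, hη.trans_lt (o i).2⟩)).1,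
    fun i U U' h => ?_, fun i U => ?_, fun U x => ?_⟩
  · refine congrArg (σ _ _) (funext₂ fun η hη => congrArg _ (h _ ?_))
    rw [OrderIso.symm_apply_le]
    exact hη
  · have := h₁ (o i).1 (o i).2 (fun η hη => (U (o.symm ⟨η, hη.trans_lt (o i).2⟩)).1)
      fun η hη => (U _).2
    rwa [show o.symm ⟨(o i).1, _⟩ = i from o.symm_apply_apply i] at this
  · classical
    have := h₂ (fun η => if hη : η < len then (U (o.symm ⟨η, hη⟩)).1 else ∅)
      (fun ξ hξ => by simpa [hξ] using (U _).2)
    have hx := this.symm ▸ mem_univ x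
    obtain ⟨_, ⟨ξ, hξ, rfl⟩, hV⟩ := hx
    refine ⟨o.symm ⟨ξ, hξ⟩, ?_⟩
    have key : ∀ (i : Iio len) (hi : i = ⟨ξ, hξ⟩),
        x ∈ σ i.1 i.2 fun η hη => (U (o.symm ⟨η, hη.trans_lt i.2⟩)).1 := by
      rintro _ rfl
      convert hV using 4 with η hη
      rw [dif_pos (hη.trans_lt hξ)]
    exact key _ (o.apply_symm_apply _)

theorem WinsG1On.playerIIWinsG1KO (o : Ω ≃o Iio len) (H : WinsG1On Ω X) :
    PlayerIIWinsG1KO X len := by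
  obtain ⟨τ, h₁, h₂, h₃⟩ := H
  refine ⟨fun ξ hξ h => τ (o.symm ⟨ξ, hξ⟩) (extendHistory o ξ h), fun ξ hξ h hh => ?_,
    fun U hU => ?_⟩
  · have := h₂ (o.symm ⟨ξ, hξ⟩) (extendHistory o ξ h)
    rwa [extendHistory_symm o ξ hξ h (hh _ _)] at this
  · refine eq_univ_of_forall fun x => ?_
    obtain ⟨i, hx⟩ := h₃ (fun j => toSubtype _ (U (o j).1)) x
    refine ⟨_, ⟨(o i).1, (o i).2, rfl⟩, ?_⟩
    rw [← extendHistory_restrict o h₁] at hx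
    beta_reduce
    rwa [show o.symm ⟨(o i).1, (o i).2⟩ = i from o.symm_apply_apply i]

end Transfer

/-- The family of finite unions of members of `C`. -/
def finiteUnions {X : Type*} (C : Set (Set X)) : Set (Set X) :=
  {V | ∃ F ⊆ C, F.Finite ∧ V = ⋃₀ F}

theorem IsOpenCover.isKCover_finiteUnions {X : Type*} [TopologicalSpace X] {C : Set (Set X)}
    (hC : IsOpenCover C) : IsKCover (finiteUnions C) := by
  refine ⟨⟨?_, ?_⟩, fun K hK => ?_⟩
  · rintro _ ⟨F, hF, -, rfl⟩
    exact isOpen_sUnion fun U hU => hC.1 U (hF hU)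
  · refine eq_univ_of_forall fun x => ?_
    obtain ⟨U, hU, hx⟩ := hC.2.symm ▸ mem_univ x
    exact ⟨U, ⟨{U}, by simpa using hU, by simp, by simp⟩, hx⟩
  · obtain ⟨F, hF, hfin, hKF⟩ := hK.elim_finite_subcover_image (b := C) (c := id)
      (fun U hU => hC.1 U hU) (by simp only [id, ← sUnion_eq_biUnion, hC.2, subset_univ])
    exact ⟨⋃₀ F, ⟨F, hF, hfin, rfl⟩, by rwa [sUnion_eq_biUnion]⟩

theorem WinsG1On.winsGfinOn {Ω X : Type*} [LinearOrder Ω] [TopologicalSpace X]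
    (H : WinsG1On Ω X) : WinsGfinOn Ω X := by
  obtain ⟨τ, h₁, h₂, h₃⟩ := H
  let K : {C : Set (Set X) // IsOpenCover C} → {C : Set (Set X) // IsKCover C} :=
    fun C => ⟨finiteUnions C.1, C.2.isKCover_finiteUnions⟩
  have hex : ∀ (C : {C : Set (Set X) // IsOpenCover C}) (V : Set X),
      ∃ F : Set (Set X), V ∈ finiteUnions C.1 → F ⊆ C.1 ∧ F.Finite ∧ V = ⋃₀ F := fun C V => by
    by_cases hV : V ∈ finiteUnions C.1
    · obtain ⟨F, hF⟩ := hV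
      exact ⟨F, fun _ => hF⟩
    · exact ⟨∅, fun h => absurd h hV⟩
  choose F hF using hex
  refine ⟨fun i U => F (U i) (τ i fun j => K (U j)), fun i U U' h => ?_, fun i U => ?_,
    fun U x => ?_⟩
  · simp only [h i le_rfl]
    rw [h₁ i _ (fun j => K (U' j)) fun j hj => by rw [h j hj]]
  · obtain ⟨a, b, -⟩ := hF (U i) _ (h₂ i fun j => K (U j))
    exact ⟨a, b⟩
  · obtain ⟨i, hi⟩ := h₃ (fun j => K (U j)) x
    refine ⟨i, ?_⟩
    obtain ⟨-, -, c⟩ := hF (U i) _ (h₂ i fun j => K (U j))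
    exact c ▸ hi

/-! ### Recursion and coding of countable sequences -/

section Recursion

variable {Ω Y : Type*} [LinearOrder Ω]

/-- Replace the values of `f` from `a` on by the default value. -/
def truncate [Inhabited Y] (f : Ω → Y) (a : Ω) : Ω → Y := fun b => if b < a then f b else default

theorem truncate_eq_iff [Inhabited Y] {f g : Ω → Y} {a : Ω} :
    truncate f a = truncate g a ↔ ∀ b < a, f b = g b := by
  refine ⟨fun h b hb => by simpa [truncate, hb] using congrFun h b, fun h => funext fun b => ?_⟩
  by_cases hb : b < a <;> simp [truncate, hb, h]

theorem truncate_truncate [Inhabited Y] (f : Ω → Y) (a : Ω) :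
    truncate (truncate f a) a = truncate f a :=
  truncate_eq_iff.2 fun b hb => by simp [truncate, hb]

theorem exists_recursive_function [WellFoundedLT Ω] [Inhabited Y] (Φ : Ω → (Ω → Y) → Y) :
    ∃ f : Ω → Y, ∀ a, f a = Φ a (truncate f a) := by
  let f : Ω → Y := WellFounded.fix (wellFounded_lt (α := Ω)) fun a ih =>
    Φ a fun b => if h : b < a then ih b h else default
  refine ⟨f, fun a => ?_⟩
  simp only [f]
  rw [WellFounded.fix_eq]
  rfl

end Recursion

section Coding

theorem exists_surjective_of_mk_le {Ω : Type} {T : Type*} [Nonempty T] (hT : lift.{0} #T ≤ lift #Ω) :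
    ∃ g : Ω → T, Function.Surjective g := by
  obtain ⟨e⟩ := lift_mk_le'.1 hT
  exact ⟨_, Function.invFun_surjective e.injective⟩

variable {Ω : Type} [LinearOrder Ω]

theorem exists_gt_of_countable (hΩ : #Ω = ℵ₁) (hI : ∀ a : Ω, (Iic a).Countable)
    {s : Set Ω} (hs : s.Countable) : ∃ b, ∀ a ∈ s, a < b := by
  by_contra! h
  have hu : (univ : Set Ω) ⊆ ⋃ a ∈ s, Iic a := fun b _ => by
    obtain ⟨a, ha, hab⟩ := h b
    exact mem_biUnion ha hab
  have hc : (univ : Set Ω).Countable := (hs.biUnion fun a _ => hI a).mono hu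
  rw [← le_aleph0_iff_set_countable, mk_univ, hΩ] at hc
  exact hc.not_gt aleph0_lt_aleph_one

theorem mk_range_truncate_le [Inhabited Ω] (CH : (𝔠 : Cardinal.{0}) = ℵ₁) (hΩ : #Ω = ℵ₁)
    (hI : ∀ a : Ω, (Iic a).Countable) :
    #(range fun p : (Ω → Ω) × Ω => (truncate p.1 p.2, p.2)) ≤ ℵ₁ := by
  let g : (Σ a : Ω, (Iio a → Ω)) → (Ω → Ω) × Ω :=
    fun p => (fun b => if h : b < p.1 then p.2 ⟨b, h⟩ else default, p.1)
  have hsub : (range fun p : (Ω → Ω) × Ω => (truncate p.1 p.2, p.2)) ⊆ range g := by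
    rintro _ ⟨⟨f, a⟩, rfl⟩
    exact ⟨⟨a, fun b => f b⟩, by simp [g]; rfl⟩
  refine (mk_le_mk_of_subset hsub).trans (mk_range_le.trans ?_)
  rw [mk_sigma]
  have hb : ∀ a : Ω, #(Iio a → Ω) ≤ ℵ₁ := fun a => by
    rw [← power_def, hΩ, ← CH]
    have hc : #(Iio a) ≤ ℵ₀ := le_aleph0_iff_set_countable.2 ((hI a).mono Iio_subset_Iic_self)
    exact (power_le_power_left continuum_ne_zero hc).trans continuum_power_aleph0.le
  refine (sum_le_sum _ _ hb).trans ?_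
  rw [sum_const', hΩ]
  exact (mul_eq_self (aleph0_le_aleph 1)).le

/-- Under CH, every countable `Ω`-sequence `f ↾ a` can be given a code in `Ω` such that
codes increase along sequences and can be decoded. -/
theorem exists_code [WellFoundedLT Ω] [Inhabited Ω] (CH : (𝔠 : Cardinal.{0}) = ℵ₁)
    (hΩ : #Ω = ℵ₁) (hI : ∀ a : Ω, (Iic a).Countable) :
    ∃ (e : (Ω → Ω) → Ω → Ω) (c : Ω → (Ω → Ω) × Ω),
      (∀ f a, c (e f a) = (truncate f a, a)) ∧ (∀ f a, ∀ b < a, e f b < e f a) ∧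
      ∀ f g a, (∀ b < a, f b = g b) → e f a = e g a := by
  let T := range fun p : (Ω → Ω) × Ω => (truncate p.1 p.2, p.2)
  have hne : Nonempty T := ⟨⟨_, ⟨default, rfl⟩⟩⟩
  have hT : #(T × Ω) ≤ #Ω := by
    rw [mk_prod, lift_id, lift_id, hΩ]
    exact (mul_le_mul_left (mk_range_truncate_le CH hΩ hI) _).trans
      (mul_eq_self (aleph0_le_aleph 1)).le
  obtain ⟨d, hd⟩ := exists_surjective_of_mk_le (Ω := Ω) (T := T × Ω) (by simpa using hT)
  have hunb : ∀ (t : T) (s : Set Ω), s.Countable → ∃ ξ, (d ξ).1 = t ∧ ∀ a ∈ s, a < ξ := by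
    intro t s hs
    obtain ⟨b, hb⟩ := exists_gt_of_countable hΩ hI hs
    by_contra! h
    have hc : (Prod.snd '' (d '' Iic b)).Countable := ((hI b).image _).image _
    refine absurd (hc.mono (s₁ := univ) fun y _ => ?_) ?_
    · obtain ⟨ξ, hξ⟩ := hd (t, y)
      obtain ⟨a, ha, hle⟩ := h ξ (by rw [hξ])
      exact ⟨(t, y), ⟨ξ, hle.trans (hb a ha).le, hξ⟩, rfl⟩
    · rw [← le_aleph0_iff_set_countable, mk_univ, hΩ]
      exact aleph0_lt_aleph_one.not_ge
  have hIio : ∀ a : Ω, (Iio a).Countable := fun a => (hI a).mono Iio_subset_Iic_self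
  choose pick hpick₁ hpick₂ using fun (f : Ω → Ω) (a : Ω) (E : Ω → Ω) =>
    hunb ⟨(truncate f a, a), ⟨(f, a), rfl⟩⟩ (E '' Iio a) ((hIio a).image E)
  choose e he using fun f : Ω → Ω =>
    exists_recursive_function fun (a : Ω) (E : Ω → Ω) => pick (truncate f a) a E
  refine ⟨e, fun ξ => (d ξ).1.1, fun f a => ?_, fun f a b hb => ?_, fun f g a => ?_⟩
  · simp only [he f a, hpick₁, truncate_truncate]
  · rw [he f a]
    refine hpick₂ _ _ _ _ ⟨b, hb, ?_⟩
    simp [truncate, hb]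
  · induction a using WellFoundedLT.induction with
    | _ a ih =>
      intro h
      rw [he f a, he g a, truncate_eq_iff.2 h, truncate_eq_iff.2 fun b hb =>
        ih b hb fun b' hb' => h b' (hb'.trans hb)]

end Coding

/-! ### From `G_fin(𝒪,𝒪)` to `G₁(𝒦,𝒪)` -/

section Main

variable {X : Type*} [TopologicalSpace X]

/-- In a regular space, the intersection over all open covers of the closures of finite
selections is compact. -/
theorem isCompact_iInter_closure_sUnion [RegularSpace X]
    (τ : {C : Set (Set X) // IsOpenCover C} → Set (Set X))
    (hτ : ∀ C, τ C ⊆ C.1 ∧ (τ C).Finite) : IsCompact (⋂ C, closure (⋃₀ τ C)) := by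
  set K := ⋂ C, closure (⋃₀ τ C)
  have hK : IsClosed K := isClosed_iInter fun _ => isClosed_closure
  refine isCompact_of_finite_subcover fun {ι} V hV hKV => ?_
  have hx : ∀ x : X, ∃ W, IsOpen W ∧ x ∈ W ∧ ((∃ i, closure W ⊆ V i) ∨ closure W ⊆ Kᶜ) := by
    intro x
    have aux : ∀ O : Set X, IsOpen O → x ∈ O → ∃ W, IsOpen W ∧ x ∈ W ∧ closure W ⊆ O := by
      intro O hO hxO
      obtain ⟨W, ⟨hxW, hW⟩, hcl⟩ :=
        (hO.mem_nhds hxO |> (nhds_basis_opens x).nhds_closure.mem_iff.1)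
      exact ⟨W, hW, hxW, hcl⟩
    by_cases hxK : x ∈ K
    · obtain ⟨i, hi⟩ := mem_iUnion.1 (hKV hxK)
      obtain ⟨W, h₁, h₂, h₃⟩ := aux _ (hV i) hi
      exact ⟨W, h₁, h₂, .inl ⟨i, h₃⟩⟩
    · obtain ⟨W, h₁, h₂, h₃⟩ := aux _ hK.isOpen_compl hxK
      exact ⟨W, h₁, h₂, .inr h₃⟩
  choose W hWo hxW hW using hx
  let C : {C : Set (Set X) // IsOpenCover C} := ⟨range W, by rintro _ ⟨x, rfl⟩; exact hWo x,
    eq_univ_of_forall fun x => ⟨W x, ⟨x, rfl⟩, hxW x⟩⟩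
  obtain ⟨hsub, hfin⟩ := hτ C
  have hex : ∀ D : Set X, ∃ s : Finset ι, D ∈ τ C → ∀ y ∈ K, y ∈ closure D → ∃ i ∈ s, y ∈ V i := by
    intro D
    by_cases hD : D ∈ τ C
    · obtain ⟨x, rfl⟩ := hsub hD
      rcases hW x with ⟨i, hi⟩ | h
      · exact ⟨{i}, fun _ y _ hy => ⟨i, by simp, hi hy⟩⟩
      · exact ⟨∅, fun _ y hyK hy => absurd hyK (h hy)⟩
    · exact ⟨∅, fun h => absurd h hD⟩
  choose s hs using hex
  classical
  refine ⟨hfin.toFinset.biUnion s, fun y hy => ?_⟩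
  have hyC : y ∈ closure (⋃₀ τ C) := mem_iInter.1 hy C
  rw [hfin.closure_sUnion] at hyC
  obtain ⟨D, hD, hyD⟩ := mem_iUnion₂.1 hyC
  obtain ⟨i, hi, hyi⟩ := hs D hD y hy hyD
  exact mem_iUnion₂.2 ⟨i, Finset.mem_biUnion.2 ⟨D, hfin.mem_toFinset.2 hD, hi⟩, hyi⟩

variable {Ω : Type} [LinearOrder Ω]

/-- If player II wins `G_fin(𝒪,𝒪)` in `ω₁` innings then every open cover has a subcover
of size at most `ℵ₁`. -/
theorem WinsGfinOn.exists_subcover [Inhabited Ω] (hΩ : #Ω = ℵ₁) (H : WinsGfinOn Ω X)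
    {C : Set (Set X)} (hC : IsOpenCover C) (hne : C.Nonempty) :
    ∃ g : Ω → Set X, (∀ i, g i ∈ C) ∧ ∀ x, ∃ i, x ∈ g i := by
  obtain ⟨σ, -, h₂, h₃⟩ := H
  obtain ⟨D₀, hD₀⟩ := hne
  have hex : ∀ i, ∃ g : ℕ → Set X, (∀ n, g n ∈ C) ∧ ∀ D ∈ σ i (fun _ => ⟨C, hC⟩), D ∈ range g := by
    intro i
    obtain ⟨hsub, hfin⟩ := h₂ i fun _ => ⟨C, hC⟩
    obtain ⟨g, hg⟩ := (hfin.insert D₀).countable.exists_eq_range (insert_nonempty _ _)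
    refine ⟨g, fun n => ?_, fun D hD => hg ▸ mem_insert_of_mem _ hD⟩
    rcases (hg ▸ mem_range_self n : g n ∈ insert D₀ _) with h | h
    exacts [h ▸ hD₀, hsub h]
  choose g hgC hg using hex
  obtain ⟨p, hp⟩ := exists_surjective_of_mk_le (Ω := Ω) (T := Ω × ℕ) (by
    simp only [mk_prod, hΩ, lift_id, mk_nat]
    exact (mul_le_mul_right (aleph0_le_aleph 1) _).trans (mul_eq_self (aleph0_le_aleph 1)).le)
  refine ⟨fun i => g (p i).1 (p i).2, fun i => hgC _ _, fun x => ?_⟩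
  obtain ⟨i, D, hD, hx⟩ := h₃ (fun _ => ⟨C, hC⟩) x
  obtain ⟨n, rfl⟩ := hg i D hD
  obtain ⟨j, hj⟩ := hp (i, n)
  exact ⟨j, by simpa [hj] using hx⟩

theorem WinsGfinOn.winsG1On [RegularSpace X] [WellFoundedLT Ω] [Inhabited Ω]
    (CH : (𝔠 : Cardinal.{0}) = ℵ₁) (hΩ : #Ω = ℵ₁) (hI : ∀ a : Ω, (Iic a).Countable)
    (H : WinsGfinOn Ω X) : WinsG1On Ω X := by
  have H' := H
  obtain ⟨σ, h₁, h₂, h₃⟩ := H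
  obtain ⟨e, c, hc, hmono, hcongr⟩ := exists_code CH hΩ hI
  let Cov := {C : Set (Set X) // IsOpenCover C}
  let R : (Ω → Cov) → Ω → Cov → Set X := fun s a W => ⋃₀ σ a (Function.update s a W)
  have hstep : ∀ (s : Ω → Cov) (a : Ω) (𝒰 : {C : Set (Set X) // IsKCover C}),
      ∃ V ∈ 𝒰.1, ∃ φ : Ω → Cov, ∀ x ∉ V, ∃ i, x ∉ R s a (φ i) := by
    intro s a 𝒰
    have hK : IsCompact (⋂ W, closure (R s a W)) :=
      isCompact_iInter_closure_sUnion (fun W => σ a (Function.update s a W)) fun W => by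
        simpa using h₂ a (Function.update s a W)
    obtain ⟨V, hV, hKV⟩ := 𝒰.2.2 _ hK
    have hcov : IsOpenCover (insert V (range fun W => (closure (R s a W))ᶜ)) := by
      refine ⟨?_, eq_univ_of_forall fun x => ?_⟩
      · rintro _ (rfl | ⟨W, rfl⟩)
        exacts [𝒰.2.1.1 _ hV, isClosed_closure.isOpen_compl]
      · by_cases hx : x ∈ V
        · exact ⟨V, mem_insert _ _, hx⟩
        · obtain ⟨W, hW⟩ := by simpa using mt (@hKV x) hx
          exact ⟨_, mem_insert_of_mem _ ⟨W, rfl⟩, hW⟩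
    obtain ⟨g, hg, hgx⟩ := H'.exists_subcover hΩ hcov (insert_nonempty _ _)
    have hφ : ∀ i, ∃ W, g i = V ∨ g i = (closure (R s a W))ᶜ := fun i => by
      rcases hg i with h | ⟨W, h⟩
      exacts [⟨default, .inl h⟩, ⟨W, .inr h.symm⟩]
    choose φ hφ using hφ
    refine ⟨V, hV, φ, fun x hx => ?_⟩
    obtain ⟨i, hi⟩ := hgx x
    rcases hφ i with h | h
    · exact absurd (h ▸ hi) hx
    · exact ⟨i, fun hxR => (h ▸ hi : x ∈ (closure (R s a (φ i)))ᶜ) (subset_closure hxR)⟩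
  choose V hV φ hφ using hstep
  -- the play of `G_fin` along the branch `f` when player I plays `U` in `G₁`
  choose B hB using fun (U : Ω → {C : Set (Set X) // IsKCover C}) (f : Ω → Ω) =>
    exists_recursive_function fun (a : Ω) (s : Ω → Cov) => φ s a (U (e f a)) (f a)
  have hBcongr : ∀ U U' f f' a, (∀ b < a, f b = f' b) → (∀ b < a, U (e f b) = U' (e f b)) →
      truncate (B U f) a = truncate (B U' f') a := by
    intro U U' f f' a
    induction a using WellFoundedLT.induction with
    | _ a ih =>
      intro hf hU
      refine truncate_eq_iff.2 fun b hb => ?_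
      rw [hB U, hB U', ih b hb (fun b' hb' => hf b' (hb'.trans hb))
        fun b' hb' => hU b' (hb'.trans hb), hU b hb, hf b hb,
        hcongr f f' b fun b' hb' => hf b' (hb'.trans hb)]
  classical
  refine ⟨fun ξ U => V (if e (c ξ).1 (c ξ).2 = ξ then truncate (B U (c ξ).1) (c ξ).2 else default)
    (c ξ).2 (U ξ), fun ξ U U' h => ?_, fun ξ U => hV _ _ _, ?_⟩
  · simp only [h ξ le_rfl]
    split_ifs with he
    · rw [hBcongr U U' _ _ _ (fun _ _ => rfl) fun b hb => h _ ?_]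
      exact (he ▸ hmono _ _ b hb).le
    · rfl
  · intro U x
    by_contra! hx
    have hex : ∀ f a, ∃ j, x ∉ R (truncate (B U f) a) a
        (φ (truncate (B U f) a) a (U (e f a)) j) := by
      intro f a
      refine hφ _ _ _ x fun hxV => hx (e f a) ?_
      rw [hc, if_pos (hcongr _ f a fun b hb => by simp [truncate, hb])]
      rwa [hBcongr U U (truncate f a) f a (fun b hb => by simp [truncate, hb]) fun _ _ => rfl]
    choose j hj using hex
    obtain ⟨f, hf⟩ := exists_recursive_function fun (a : Ω) (f : Ω → Ω) => j f a
    obtain ⟨a, ha⟩ := h₃ (B U f) x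
    refine hj (truncate f a) a ?_
    have ht : ∀ b < a, truncate f a b = f b := fun b hb => by simp [truncate, hb]
    rw [← hf, hBcongr U U (truncate f a) f a ht fun _ _ => rfl, hcongr _ f a ht, ← hB]
    simp only [R]
    rwa [h₁ a _ (B U f)]
    intro b hb
    rcases hb.eq_or_lt with rfl | hb
    · simp
    · rw [Function.update_of_ne hb.ne]
      simp [truncate, hb]

end Main

theorem nonempty_toType_orderIso_Iio_ord_aleph_one :
    Nonempty ((ℵ₁ : Cardinal.{0}).ord.ToType ≃o Iio (Cardinal.aleph.{u} 1).ord) := by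
  have h : Ordinal.lift.{u + 1} (Ordinal.type (α := (ℵ₁ : Cardinal.{0}).ord.ToType) (· < ·)) =
      Ordinal.lift.{0} (Ordinal.type (α := Iio (Cardinal.aleph.{u} 1).ord) (· < ·)) := by
    simp
  obtain ⟨r⟩ := Ordinal.lift_type_eq.1 h
  exact ⟨OrderIso.ofRelIsoLT r⟩

/-- [CH] For a Tychonoff space `X`, player II has a winning strategy in
`G_fin^{ω₁}(𝒪,𝒪)` iff player II has a winning strategy in `G₁^{ω₁}(𝒦,𝒪)`. -/
theorem stmt11 {X : Type*} [TopologicalSpace X] [T35Space X]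
    (CH : Cardinal.continuum = Cardinal.aleph 1) :
    PlayerIIWinsGfinOO X (Cardinal.aleph 1).ord ↔
      PlayerIIWinsG1KO X (Cardinal.aleph 1).ord := by
  have CH' : (𝔠 : Cardinal.{0}) = ℵ₁ := by
    apply lift_injective
    simpa using CH
  have hΩ : #(ℵ₁ : Cardinal.{0}).ord.ToType = ℵ₁ := mk_ord_toType _
  have hI : ∀ a : (ℵ₁ : Cardinal.{0}).ord.ToType, (Iic a).Countable := fun a => by
    rw [← Iio_insert]
    refine (le_aleph0_iff_set_countable.1 ?_).insert a
    rw [← Order.lt_succ_iff, succ_aleph0]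
    exact (mk_Iio_lt a (by simp)).trans_eq hΩ
  have hne : Nonempty (ℵ₁ : Cardinal.{0}).ord.ToType := by
    rw [← mk_ne_zero_iff, hΩ]
    exact (aleph_pos 1).ne'
  have : Inhabited (ℵ₁ : Cardinal.{0}).ord.ToType := Classical.inhabited_of_nonempty hne
  obtain ⟨o⟩ := nonempty_toType_orderIso_Iio_ord_aleph_one
  obtain ⟨o'⟩ := nonempty_toType_orderIso_Iio_ord_aleph_one
  exact ⟨fun H => ((H.winsGfinOn o).winsG1On CH' hΩ hI).playerIIWinsG1KO o',
    fun H => (H.winsG1On o').winsGfinOn.playerIIWinsGfinOO o⟩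
end
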